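/- Let K be an entrywise positive m×n real matrix with m ≥ n ≥ 2 and rank(K) = n, let a ∈ ℝ^m, b ∈ ℝ^n be entrywise positive vectors with Σ_i a_i = Σ_j b_j = 1, let (u*, v*) be a solution of the scaling problem, and assume ϑ² < 1. Then for every ω with 1 < ω < 1 + δ₁ one has ρ_ϑ(ω) < ϑ², i.e. the asymptotic rate of the overrelaxed method is strictly smaller than that of the standard Sinkhorn method, where δ₁ = (a_min / b_max) · (1 − b_max) / ((‖K‖_∞/σ_min(K))² − a_min). -/

import Mathlib

open Matrix

/-- The asymptotic convergence rate ρ_ϑ(ω) of the overrelaxed Sinkhorn method. -/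
noncomputable def sinkhornRate (θ ω : ℝ) : ℝ :=
  if ω ≤ 2 / (1 + Real.sqrt (1 - θ ^ 2)) then
    1 / 4 * (ω * θ + Real.sqrt (ω ^ 2 * θ ^ 2 - 4 * (ω - 1))) ^ 2
  else ω - 1

/-- The matrix H = diag(u*/√a) K diag(v*∘v*/b) Kᵀ diag(u*/√a). -/
noncomputable def Hmat {m n : ℕ} (K : Matrix (Fin m) (Fin n) ℝ)
    (a : Fin m → ℝ) (b : Fin n → ℝ) (u : Fin m → ℝ) (v : Fin n → ℝ) :
    Matrix (Fin m) (Fin m) ℝ :=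
  Matrix.diagonal (fun i => u i / Real.sqrt (a i)) * K *
    Matrix.diagonal (fun j => v j * v j / b j) * Kᵀ *
    Matrix.diagonal (fun i => u i / Real.sqrt (a i))

/-- ϑ² = sup of the Rayleigh quotient of H over the orthogonal complement of √a. -/
noncomputable def thetaSq {m n : ℕ} (K : Matrix (Fin m) (Fin n) ℝ)
    (a : Fin m → ℝ) (b : Fin n → ℝ) (u : Fin m → ℝ) (v : Fin n → ℝ) : ℝ :=
  sSup {r : ℝ | ∃ w : Fin m → ℝ, w ≠ 0 ∧ (w ⬝ᵥ fun i => Real.sqrt (a i)) = 0 ∧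
    r = w ⬝ᵥ (Hmat K a b u v).mulVec w / (w ⬝ᵥ w)}

/-- Maximum absolute row-sum norm ‖K‖_∞. -/
noncomputable def normInfRow {m n : ℕ} (K : Matrix (Fin m) (Fin n) ℝ) : ℝ :=
  ⨆ i, ∑ j, |K i j|

/-- The smallest positive singular value of K. -/
noncomputable def sigmaMin {m n : ℕ} (K : Matrix (Fin m) (Fin n) ℝ) : ℝ :=
  sInf {s : ℝ | 0 < s ∧ ∃ x : Fin n → ℝ, x ≠ 0 ∧ (Kᵀ * K).mulVec x = (s ^ 2) • x}

theorem sinkhornRate_lt_sq {θ ω : ℝ} (hθ0 : 0 < θ) (hθ1 : θ ^ 2 < 1) (hω1 : 1 < ω)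
    (hω : ω < 1 + θ ^ 2) : sinkhornRate θ ω < θ ^ 2 := by
  unfold sinkhornRate
  split_ifs
  · have hsqrt : Real.sqrt (ω ^ 2 * θ ^ 2 - 4 * (ω - 1)) < (2 - ω) * θ := by
      rw [Real.sqrt_lt' (mul_pos (by linarith) hθ0)]
      nlinarith [mul_pos (sub_pos.2 hω1) (sub_pos.2 hθ1)]
    have hsum : (ω * θ + Real.sqrt (ω ^ 2 * θ ^ 2 - 4 * (ω - 1))) ^ 2 < (2 * θ) ^ 2 := by
      apply pow_lt_pow_left₀ _ (by positivity) two_ne_zero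
      linarith
    linarith [mul_pow 2 θ 2]
  · linarith

theorem sigmaMin_nonneg {m n : ℕ} (K : Matrix (Fin m) (Fin n) ℝ) : 0 ≤ sigmaMin K :=
  Real.sInf_nonneg fun _ hs => hs.1.le

theorem mulVec_injective_of_rank_eq {m n : ℕ} {K : Matrix (Fin m) (Fin n) ℝ}
    (hrank : K.rank = n) : Function.Injective K.mulVec := by
  rw [Matrix.mulVec_injective_iff, linearIndependent_iff_card_eq_finrank_span,
    Set.finrank, ← Matrix.rank_eq_finrank_span_cols, hrank, Fintype.card_fin]

theorem posDef_transpose_mul_self {m n : ℕ} {K : Matrix (Fin m) (Fin n) ℝ}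
    (hrank : K.rank = n) : (Kᵀ * K).PosDef := by
  simpa using Matrix.PosDef.conjTranspose_mul_self K (mulVec_injective_of_rank_eq hrank)

theorem sigmaMin_sq_mul_dotProduct_le {m n : ℕ} {K : Matrix (Fin m) (Fin n) ℝ}
    (hrank : K.rank = n) (x : Fin n → ℝ) :
    sigmaMin K ^ 2 * (x ⬝ᵥ x) ≤ x ⬝ᵥ (Kᵀ * K) *ᵥ x := by
  have hpos := posDef_transpose_mul_self hrank
  have hherm : (Kᵀ * K - sigmaMin K ^ 2 • (1 : Matrix (Fin n) (Fin n) ℝ)).IsHermitian := by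
    apply hpos.1.sub
    simp [Matrix.IsHermitian]
  have hpsd : (Kᵀ * K - sigmaMin K ^ 2 • (1 : Matrix (Fin n) (Fin n) ℝ)).PosSemidef := by
    rw [hherm.posSemidef_iff_eigenvalues_nonneg]
    intro i
    set y : Fin n → ℝ := (hherm.eigenvectorBasis i).ofLp
    set μ := hherm.eigenvalues i
    have hy : y ≠ 0 := by
      intro h
      exact hherm.eigenvectorBasis.orthonormal.ne_zero i (WithLp.ofLp_injective 2 h)
    have heig : (Kᵀ * K) *ᵥ y = (μ + sigmaMin K ^ 2) • y := by
      have := hherm.mulVec_eigenvectorBasis i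
      rw [Matrix.sub_mulVec, Matrix.smul_mulVec, Matrix.one_mulVec, sub_eq_iff_eq_add] at this
      rw [add_smul]
      exact this
    have hμ : 0 < μ + sigmaMin K ^ 2 := by
      have h1 := hpos.dotProduct_mulVec_pos hy
      rw [heig, dotProduct_smul, smul_eq_mul] at h1
      have h2 : 0 ≤ star y ⬝ᵥ y := dotProduct_star_self_nonneg y
      exact pos_of_mul_pos_left h1 h2
    have hle : sigmaMin K ≤ Real.sqrt (μ + sigmaMin K ^ 2) := by
      apply csInf_le ⟨0, fun _ hs => hs.1.le⟩
      exact ⟨Real.sqrt_pos.2 hμ, y, hy, by rw [Real.sq_sqrt hμ.le, heig]⟩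
    have := (Real.le_sqrt (sigmaMin_nonneg K) hμ.le).1 hle
    simpa using this
  have := hpsd.dotProduct_mulVec_nonneg x
  simp only [star_trivial, Matrix.sub_mulVec, Matrix.smul_mulVec, Matrix.one_mulVec,
    dotProduct_sub, dotProduct_smul, smul_eq_mul] at this
  linarith

theorem exists_transpose_mulVec_eq_single {m n : ℕ} {K : Matrix (Fin m) (Fin n) ℝ}
    (hrank : K.rank = n) (j : Fin n) :
    ∃ p : Fin m → ℝ, Kᵀ *ᵥ p = Pi.single j 1 ∧ sigmaMin K ^ 2 * (p ⬝ᵥ p) ≤ 1 := by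
  have hpos := posDef_transpose_mul_self hrank
  set x : Fin n → ℝ := (Kᵀ * K)⁻¹ *ᵥ Pi.single j 1
  have hx : (Kᵀ * K) *ᵥ x = Pi.single j 1 := by
    rw [Matrix.mulVec_mulVec, Matrix.mul_nonsing_inv _ ((Matrix.isUnit_iff_isUnit_det _).1
      hpos.isUnit), Matrix.one_mulVec]
  have hp : (K *ᵥ x) ⬝ᵥ (K *ᵥ x) = x j := by
    rw [dotProduct_mulVec, Matrix.vecMul_mulVec, ← dotProduct_mulVec, hx]
    simp
  refine ⟨K *ᵥ x, by rw [Matrix.mulVec_mulVec, hx], ?_⟩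
  have h1 := sigmaMin_sq_mul_dotProduct_le hrank x
  rw [hx, dotProduct_single, mul_one] at h1
  have h2 : x j ^ 2 ≤ x ⬝ᵥ x := by
    rw [pow_two]
    exact Finset.single_le_sum (f := fun i => x i * x i) (fun i _ => mul_self_nonneg _)
      (Finset.mem_univ j)
  have h3 : 0 ≤ x j := hp ▸ Finset.sum_nonneg fun i _ => mul_self_nonneg _
  rw [hp]
  rcases h3.eq_or_lt with h | h
  · rw [← h]; simp
  · have := mul_le_mul_of_nonneg_left h2 (sq_nonneg (sigmaMin K))
    refine le_of_mul_le_mul_right ?_ h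
    linarith

theorem dotProduct_Hmat_mulVec {m n : ℕ} (K : Matrix (Fin m) (Fin n) ℝ)
    (a : Fin m → ℝ) (b : Fin n → ℝ) (u : Fin m → ℝ) (v : Fin n → ℝ) (w : Fin m → ℝ) :
    w ⬝ᵥ Hmat K a b u v *ᵥ w =
      ∑ j, v j * v j / b j * (Kᵀ *ᵥ fun i => u i / Real.sqrt (a i) * w i) j ^ 2 := by
  set z : Fin m → ℝ := fun i => u i / Real.sqrt (a i) * w i
  have hz : (Matrix.diagonal fun i => u i / Real.sqrt (a i)) *ᵥ w = z := by
    ext i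
    simp [z, Matrix.mulVec_diagonal]
  have hz' : w ᵥ* (Matrix.diagonal fun i => u i / Real.sqrt (a i)) = z := by
    ext i
    simp [z, Matrix.vecMul_diagonal, mul_comm]
  unfold Hmat
  rw [← Matrix.mulVec_mulVec, hz, ← Matrix.mulVec_mulVec, ← Matrix.mulVec_mulVec,
    ← Matrix.mulVec_mulVec, dotProduct_mulVec, hz', dotProduct_mulVec, ← Matrix.mulVec_transpose]
  refine Finset.sum_congr rfl fun j _ => ?_
  rw [Matrix.mulVec_diagonal]
  ring

theorem bddAbove_rayleigh_Hmat {m n : ℕ} (K : Matrix (Fin m) (Fin n) ℝ)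
    (a : Fin m → ℝ) {b : Fin n → ℝ} (hb : ∀ j, 0 < b j) (u : Fin m → ℝ) (v : Fin n → ℝ) :
    BddAbove {r : ℝ | ∃ w : Fin m → ℝ, w ≠ 0 ∧ (w ⬝ᵥ fun i => Real.sqrt (a i)) = 0 ∧
      r = w ⬝ᵥ (Hmat K a b u v).mulVec w / (w ⬝ᵥ w)} := by
  refine ⟨∑ j, v j * v j / b j * ∑ i, (K i j * (u i / Real.sqrt (a i))) ^ 2, ?_⟩
  rintro r ⟨w, hw, -, rfl⟩
  refine div_le_of_le_mul₀ (Finset.sum_nonneg fun i _ => mul_self_nonneg _)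
    (Finset.sum_nonneg fun j _ => mul_nonneg (div_nonneg (mul_self_nonneg _) (hb j).le)
      (Finset.sum_nonneg fun i _ => sq_nonneg _)) ?_
  rw [dotProduct_Hmat_mulVec, Finset.sum_mul]
  refine Finset.sum_le_sum fun j _ => ?_
  rw [mul_assoc]
  refine mul_le_mul_of_nonneg_left ?_ (div_nonneg (mul_self_nonneg _) (hb j).le)
  have h := Finset.sum_mul_sq_le_sq_mul_sq Finset.univ
    (fun i => K i j * (u i / Real.sqrt (a i))) w
  simpa only [Matrix.mulVec, dotProduct, Matrix.transpose_apply, mul_assoc, ← pow_two] using h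

theorem mulVec_le_normInfRow_mul {m n : ℕ} (K : Matrix (Fin m) (Fin n) ℝ) {v : Fin n → ℝ}
    (hv : ∀ j, 0 ≤ v j) {c : ℝ} (hc : 0 ≤ c) (hvc : ∀ j, v j ≤ c) (i : Fin m) :
    (K *ᵥ v) i ≤ normInfRow K * c := by
  calc (K *ᵥ v) i ≤ ∑ j, |K i j| * c := by
        rw [Matrix.mulVec, dotProduct]
        exact Finset.sum_le_sum fun j _ => mul_le_mul (le_abs_self _) (hvc j) (hv j) (abs_nonneg _)
    _ = (∑ j, |K i j|) * c := by rw [Finset.sum_mul]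
    _ ≤ normInfRow K * c := mul_le_mul_of_nonneg_right
        (le_ciSup (f := fun i => ∑ j, |K i j|) (Set.finite_range _).bddAbove i) hc

/-- A Rayleigh quotient bound for `H`: if `Kᵀ p = e_j`, the projection onto `√a^⊥` of
`p ∘ (K v) / √a` is a test vector for `ϑ²`. -/
theorem mul_le_thetaSq {m n : ℕ} {K : Matrix (Fin m) (Fin n) ℝ}
    {a : Fin m → ℝ} {b : Fin n → ℝ} (ha : ∀ i, 0 < a i) (hb : ∀ j, 0 < b j)
    (hsuma : ∑ i, a i = 1) (hsumb : ∑ j, b j = 1) {u : Fin m → ℝ} {v : Fin n → ℝ}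
    (hv : ∀ j, 0 < v j) (hsol1 : ∀ i, u i * (K *ᵥ v) i = a i)
    (hsol2 : ∀ j, v j * (Kᵀ *ᵥ u) j = b j) {j₀ : Fin n} (hj₀ : b j₀ < 1) {p : Fin m → ℝ}
    (hp : Kᵀ *ᵥ p = Pi.single j₀ 1) :
    0 < ∑ i, p i ^ 2 * (K *ᵥ v) i ^ 2 / a i - v j₀ ^ 2 ∧
      v j₀ ^ 2 * (1 / b j₀ - 1) / (∑ i, p i ^ 2 * (K *ᵥ v) i ^ 2 / a i - v j₀ ^ 2) ≤
        thetaSq K a b u v := by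
  set c := v j₀
  set w : Fin m → ℝ := fun i => p i * (K *ᵥ v) i / Real.sqrt (a i) - c * Real.sqrt (a i)
  have hs : ∀ i, 0 < Real.sqrt (a i) := fun i => Real.sqrt_pos.2 (ha i)
  have hss : ∀ i, Real.sqrt (a i) ^ 2 = a i := fun i => Real.sq_sqrt (ha i).le
  have hpv : ∑ i, p i * (K *ᵥ v) i = c := by
    change p ⬝ᵥ K *ᵥ v = c
    rw [dotProduct_mulVec, ← Matrix.mulVec_transpose, hp]
    simp [c]
  have horth : (w ⬝ᵥ fun i => Real.sqrt (a i)) = 0 := by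
    have : ∀ i, w i * Real.sqrt (a i) = p i * (K *ᵥ v) i - c * a i := by
      intro i
      have := (hs i).ne'
      simp only [w]
      rw [← hss i, Real.sqrt_sq (hs i).le]
      field_simp
    simp only [dotProduct, this, Finset.sum_sub_distrib, hpv, ← Finset.mul_sum, hsuma]
    ring
  have hnorm : w ⬝ᵥ w = ∑ i, p i ^ 2 * (K *ᵥ v) i ^ 2 / a i - c ^ 2 := by
    have : ∀ i, w i * w i = p i ^ 2 * (K *ᵥ v) i ^ 2 / a i - 2 * c * (p i * (K *ᵥ v) i)
        + c ^ 2 * a i := by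
      intro i
      have := (hs i).ne'
      simp only [w]
      rw [← hss i, Real.sqrt_sq (hs i).le]
      field_simp
      ring
    simp only [dotProduct, this, Finset.sum_sub_distrib, Finset.sum_add_distrib, hpv,
      ← Finset.mul_sum, hsuma]
    ring
  have hz : (fun i => u i / Real.sqrt (a i) * w i) = p - c • u := by
    ext i
    have h0 := (hs i).ne'
    have h1 := hsol1 i
    have h2 := hss i
    simp only [w, Pi.sub_apply, Pi.smul_apply, smul_eq_mul]
    field_simp
    rw [h2]
    linear_combination p i * h1
  have hquad : w ⬝ᵥ Hmat K a b u v *ᵥ w = c ^ 2 * (1 / b j₀ - 1) := by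
    rw [dotProduct_Hmat_mulVec, hz, Matrix.mulVec_sub, Matrix.mulVec_smul, hp]
    have : ∀ j, v j * v j / b j * ((Pi.single j₀ 1 - c • Kᵀ *ᵥ u : Fin n → ℝ) j) ^ 2 =
        (Pi.single j₀ (c ^ 2 / b j₀ - 2 * c ^ 2) : Fin n → ℝ) j + c ^ 2 * b j := by
      intro j
      have hb' := (hb j).ne'
      have h2 := hsol2 j
      simp only [Pi.sub_apply, Pi.smul_apply, smul_eq_mul]
      rcases eq_or_ne j j₀ with rfl | hj
      · simp only [Pi.single_eq_same, c] at h2 ⊢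
        rw [h2]
        field_simp
        ring
      · simp only [Pi.single_eq_of_ne hj]
        field_simp
        rw [← h2]
        ring
    simp only [this, Finset.sum_add_distrib, ← Finset.mul_sum, hsumb]
    simp
    ring
  have hquad_pos : 0 < w ⬝ᵥ Hmat K a b u v *ᵥ w := by
    rw [hquad]
    exact mul_pos (pow_pos (hv j₀) 2) (sub_pos.2 ((one_lt_div (hb j₀)).2 hj₀))
  have hw : w ≠ 0 := by
    rintro h
    simp [h] at hquad_pos
  rw [← hnorm, ← hquad]
  refine ⟨?_, le_csSup (bddAbove_rayleigh_Hmat K a hb u v) ⟨w, hw, horth, rfl⟩⟩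
  simpa using dotProduct_star_self_pos_iff.2 hw
theorem faster_rate_on_a_priori_interval
    {m n : ℕ} (hn : 2 ≤ n) (hnm : n ≤ m)
    (K : Matrix (Fin m) (Fin n) ℝ) (hK : ∀ i j, 0 < K i j) (hrank : K.rank = n)
    (a : Fin m → ℝ) (b : Fin n → ℝ) (ha : ∀ i, 0 < a i) (hb : ∀ j, 0 < b j)
    (hsuma : ∑ i, a i = 1) (hsumb : ∑ j, b j = 1)
    (ustar : Fin m → ℝ) (vstar : Fin n → ℝ)
    (hustar : ∀ i, 0 < ustar i) (hvstar : ∀ j, 0 < vstar j)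
    (hsol1 : ∀ i, ustar i * K.mulVec vstar i = a i)
    (hsol2 : ∀ j, vstar j * Kᵀ.mulVec ustar j = b j)
    (hθ1 : thetaSq K a b ustar vstar < 1)
    (ω : ℝ) (hω1 : 1 < ω)
    (hωδ : ω < 1 + (⨅ i, a i) / (⨆ j, b j) * (1 - ⨆ j, b j) /
        ((normInfRow K / sigmaMin K) ^ 2 - ⨅ i, a i)) :
    sinkhornRate (Real.sqrt (thetaSq K a b ustar vstar)) ω <
      thetaSq K a b ustar vstar := by
  have : NeZero n := ⟨by omega⟩
  have : NeZero m := ⟨by omega⟩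
  set α := ⨅ i, a i
  set β := ⨆ j, b j
  have hα : ∀ i, α ≤ a i := ciInf_le (Set.finite_range a).bddBelow
  have hβ : ∀ j, b j ≤ β := le_ciSup (Set.finite_range b).bddAbove
  have hα0 : 0 < α := by
    obtain ⟨i, hi⟩ := exists_eq_ciInf_of_finite (f := a)
    exact (ha i).trans_eq hi
  have hb1 : ∀ j, b j < 1 := by
    have : Nontrivial (Fin n) := Fin.nontrivial_iff_two_le.2 hn
    intro j
    obtain ⟨k, hk⟩ := exists_ne j
    rw [← hsumb]
    exact Finset.single_lt_sum hk (Finset.mem_univ j) (Finset.mem_univ k) (hb k)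
      fun l _ _ => (hb l).le
  have hβ0 : 0 < β := (hb 0).trans_le (hβ 0)
  have hβ1 : β < 1 := by
    obtain ⟨j, hj⟩ := exists_eq_ciSup_of_finite (f := b)
    exact hj.symm.trans_lt (hb1 j)
  set D := (normInfRow K / sigmaMin K) ^ 2 - α with hD
  have hD0 : 0 < D := by
    by_contra! h
    have : α / β * (1 - β) / D ≤ 0 :=
      div_nonpos_of_nonneg_of_nonpos (by have := sub_pos.2 hβ1; positivity) h
    linarith
  have hσ : 0 < sigmaMin K := by
    refine (sigmaMin_nonneg K).lt_of_ne fun h => ?_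
    rw [hD, ← h] at hD0
    simp at hD0
    linarith
  obtain ⟨j₀, hj₀⟩ := Finite.exists_max vstar
  obtain ⟨p, hp, hpσ⟩ := exists_transpose_mulVec_eq_single hrank j₀
  obtain ⟨hW, hθ⟩ := mul_le_thetaSq ha hb hsuma hsumb hvstar hsol1 hsol2 (hb1 j₀) hp
  set W := ∑ i, p i ^ 2 * (K *ᵥ vstar) i ^ 2 / a i
  set c := vstar j₀
  have hc : 0 < c := hvstar j₀
  have hWle : W ≤ (normInfRow K / sigmaMin K) ^ 2 * c ^ 2 / α := by
    have hKv : ∀ i, 0 ≤ (K *ᵥ vstar) i := fun i => by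
      rw [Matrix.mulVec, dotProduct]
      exact Finset.sum_nonneg fun j _ => (mul_pos (hK i j) (hvstar j)).le
    calc W ≤ ∑ i, p i ^ 2 * (normInfRow K * c) ^ 2 / α := by
          refine Finset.sum_le_sum fun i _ => ?_
          gcongr
          · exact hKv i
          · exact mulVec_le_normInfRow_mul K (fun j => (hvstar j).le) hc.le hj₀ i
          · exact hα i
      _ = (p ⬝ᵥ p) * (normInfRow K * c) ^ 2 / α := by
          simp only [dotProduct, Finset.sum_mul, Finset.sum_div, pow_two]
      _ ≤ 1 / sigmaMin K ^ 2 * (normInfRow K * c) ^ 2 / α := by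
          gcongr
          rw [le_div_iff₀' (pow_pos hσ 2)]
          exact hpσ
      _ = (normInfRow K / sigmaMin K) ^ 2 * c ^ 2 / α := by ring
  have hδ : α / β * (1 - β) / D ≤ thetaSq K a b ustar vstar := by
    refine le_trans ?_ hθ
    calc α / β * (1 - β) / D = c ^ 2 * (1 / β - 1) / (c ^ 2 * D / α) := by field_simp
      _ ≤ c ^ 2 * (1 / b j₀ - 1) / (W - c ^ 2) := by
          have h1 : 1 / β ≤ 1 / b j₀ := one_div_le_one_div_of_le (hb j₀) (hβ j₀)
          have h2 : 1 < 1 / β := (one_lt_div hβ0).2 hβ1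
          have h3 : W - c ^ 2 ≤ c ^ 2 * D / α := by
            have : c ^ 2 * D / α = (normInfRow K / sigmaMin K) ^ 2 * c ^ 2 / α - c ^ 2 := by
              rw [hD]
              field_simp
            linarith
          gcongr
          nlinarith [pow_pos hc 2]
  have hθ0 : 0 < thetaSq K a b ustar vstar := by linarith
  have hsq := Real.sq_sqrt hθ0.le
  have := sinkhornRate_lt_sq (Real.sqrt_pos.2 hθ0) (hsq.trans_lt hθ1) hω1
    (by rw [hsq]; linarith)
  rwa [hsq] at this
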